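/- If e is a degree-2 operator on a finite-dimensional graded real vector space V = ⊕ V^k satisfying hard Lefschetz (e^i : V^{-i} → V^i is an isomorphism for all i ≥ 0), then there exist operators f (degree -2) and h (with h acting on V^k by multiplication by k) making (e, h, f) an 𝔰𝔩_2(ℝ)-triple: [h,e] = 2e, [h,f] = -2f, [e,f] = h. -/

import Mathlib

theorem aux_glue {V : Type} [AddCommGroup V] [Module ℝ V]
    (p : ℤ → Submodule ℝ V) (hp : DirectSum.IsInternal p) (φ : ℤ → Module.End ℝ V) :
    ∃ f : Module.End ℝ V, ∀ k : ℤ, ∀ x ∈ p k, f x = φ k x := by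
  classical
  let E := LinearEquiv.ofBijective (DirectSum.coeLinearMap p) hp
  refine ⟨(DirectSum.toModule ℝ ℤ V (fun k => (φ k).comp (p k).subtype)).comp
    E.symm.toLinearMap, ?_⟩
  intro k x hx
  have h1 : E (DirectSum.lof ℝ ℤ (fun k => p k) k ⟨x, hx⟩) = x := by
    exact DirectSum.coeLinearMap_lof p k ⟨x, hx⟩
  have h2 : E.symm x = DirectSum.lof ℝ ℤ (fun k => p k) k ⟨x, hx⟩ := by
    rw [LinearEquiv.symm_apply_eq, h1]
  simp [h2]

theorem aux_ext {V : Type} [AddCommGroup V] [Module ℝ V]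
    (p : ℤ → Submodule ℝ V) (hp : DirectSum.IsInternal p) (f g : Module.End ℝ V)
    (h : ∀ k : ℤ, ∀ x ∈ p k, f x = g x) : f = g := by
  ext x
  have hx : x ∈ iSup p := by rw [hp.submodule_iSup_eq_top]; trivial
  induction hx using Submodule.iSup_induction' with
  | mem i x hx => exact h i x hx
  | zero => simp
  | add x y _ _ h1 h2 => simp [h1, h2]

theorem aux_inv {V : Type} [AddCommGroup V] [Module ℝ V]
    (A B : Submodule ℝ V) (u : Module.End ℝ V) (hu : ∀ x ∈ A, u x ∈ B)
    (hinj : ∀ x ∈ A, u x = 0 → x = 0) (hsurj : ∀ y ∈ B, ∃ x ∈ A, u x = y) :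
    ∃ L : Module.End ℝ V, (∀ y ∈ B, L y ∈ A ∧ u (L y) = y) ∧ ∀ x ∈ A, L (u x) = x := by
  let T : A →ₗ[ℝ] B := u.restrict hu
  have hT : Function.Bijective T := by
    constructor
    · rw [← LinearMap.ker_eq_bot, LinearMap.ker_eq_bot']
      intro x hx
      exact Subtype.ext (hinj x x.2 (congrArg Subtype.val hx))
    · intro y
      obtain ⟨x, hx, h⟩ := hsurj y y.2
      exact ⟨⟨x, hx⟩, Subtype.ext h⟩
  let E := LinearEquiv.ofBijective T hT
  obtain ⟨L, hL⟩ := LinearMap.exists_extend (A.subtype.comp E.symm.toLinearMap)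
  have h1 : ∀ y (hy : y ∈ B), L y = E.symm ⟨y, hy⟩ := fun y hy =>
    LinearMap.congr_fun hL ⟨y, hy⟩
  have h2 : ∀ y ∈ B, L y ∈ A ∧ u (L y) = y := by
    intro y hy
    rw [h1 y hy]
    exact ⟨(E.symm ⟨y, hy⟩).2, congrArg Subtype.val (E.apply_symm_apply ⟨y, hy⟩)⟩
  refine ⟨L, h2, fun x hx => ?_⟩
  have h3 := h2 (u x) (hu x hx)
  exact sub_eq_zero.1 (hinj _ (A.sub_mem h3.1 hx) (by rw [map_sub, h3.2, sub_self]))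

/-- Fuelled recursion for the lowering operator in non-positive degrees. -/
def auxG {V : Type} [AddCommGroup V] [Module ℝ V]
    (e : Module.End ℝ V) (g : ℕ → Module.End ℝ V) : ℕ → ℕ → Module.End ℝ V
  | 0, _ => 0
  | m + 1, n => e * auxG e g m (n + 2) * g n + ((n : ℝ) + 2) • g n

theorem aux_F {V : Type} [AddCommGroup V] [Module ℝ V] [FiniteDimensional ℝ V]
    (p : ℤ → Submodule ℝ V) (hp : DirectSum.IsInternal p) (e : Module.End ℝ V)
    (hdeg : ∀ i : ℤ, ∀ x ∈ p i, e x ∈ p (i + 2)) (g : ℕ → Module.End ℝ V)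
    (hg : ∀ n : ℕ, ∀ x ∈ p (-(n : ℤ)), g n x ∈ p (-((n + 2 : ℕ) : ℤ))) :
    ∃ F : ℕ → Module.End ℝ V, ∀ n : ℕ, ∀ x ∈ p (-(n : ℤ)),
      F n x ∈ p (-((n + 2 : ℕ) : ℤ)) ∧
      F n x = e (F (n + 2) (g n x)) + ((n : ℝ) + 2) • g n x := by
  have hfin : {i | p i ≠ ⊥}.Finite :=
    WellFoundedGT.finite_ne_bot_of_iSupIndep hp.submodule_iSupIndep
  obtain ⟨b, hb⟩ := hfin.bddBelow
  have hN : ∀ n : ℕ, b.natAbs + 1 ≤ n → p (-(n : ℤ)) = ⊥ := by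
    intro n hn
    by_contra h
    have := hb h
    omega
  have hmem : ∀ m n : ℕ, ∀ x ∈ p (-(n : ℤ)), auxG e g m n x ∈ p (-((n + 2 : ℕ) : ℤ)) := by
    intro m
    induction m with
    | zero => intro n x hx; simp [auxG]
    | succ m ih =>
      intro n x hx
      have h1 := hdeg _ _ (ih (n + 2) _ (hg n x hx))
      rw [show (-((n + 2 + 2 : ℕ) : ℤ)) + 2 = -((n + 2 : ℕ) : ℤ) by push_cast; ring] at h1
      exact Submodule.add_mem _ h1 (Submodule.smul_mem _ _ (hg n x hx))
  have hstab : ∀ m n : ℕ, b.natAbs + 1 ≤ n + m → ∀ x ∈ p (-(n : ℤ)),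
      auxG e g m n x = auxG e g (m + 1) n x := by
    intro m
    induction m with
    | zero =>
      intro n hn x hx
      rw [hN n (by omega), Submodule.mem_bot] at hx
      simp [hx]
    | succ m ih =>
      intro n hn x hx
      have h1 := ih (n + 2) (by omega) _ (hg n x hx)
      change e (auxG e g m (n + 2) (g n x)) + _ = e (auxG e g (m + 1) (n + 2) (g n x)) + _
      rw [h1]
  refine ⟨fun n => auxG e g (b.natAbs + 1) n, fun n x hx => ⟨hmem _ _ _ hx, ?_⟩⟩
  exact hstab _ n (by omega) x hx

/-- **Jacobson–Morozov for Lefschetz operators.**  If `e` is a degree-2 operator on a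
finite-dimensional graded real vector space `V = ⊕ V^k` satisfying hard Lefschetz
(`e^i : V^{-i} → V^i` is an isomorphism for all `i ≥ 0`), then there exist operators
`f` (of degree `-2`) and `h` (acting on `V^k` by multiplication by `k`) making
`(e, h, f)` an `𝔰𝔩₂(ℝ)`-triple: `[h,e] = 2e`, `[h,f] = -2f`, `[e,f] = h`. -/
theorem sl2_completion_of_hard_lefschetz
    (V : Type) [AddCommGroup V] [Module ℝ V] [FiniteDimensional ℝ V]
    (p : ℤ → Submodule ℝ V) (hp : DirectSum.IsInternal p)
    (e : Module.End ℝ V)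
    (hdeg : ∀ i : ℤ, ∀ x ∈ p i, e x ∈ p (i + 2))
    (hHL : ∀ i : ℕ,
      (∀ x ∈ p (-(i : ℤ)), (e ^ i) x = 0 → x = 0) ∧
      (∀ y ∈ p (i : ℤ), ∃ x ∈ p (-(i : ℤ)), (e ^ i) x = y)) :
    ∃ f h : Module.End ℝ V,
      (∀ k : ℤ, ∀ x ∈ p k, h x = (k : ℝ) • x) ∧
      (∀ k : ℤ, ∀ x ∈ p k, f x ∈ p (k - 2)) ∧
      h * e - e * h = 2 • e ∧
      h * f - f * h = -(2 • f) ∧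
      e * f - f * e = h := by
  have hpow : ∀ m : ℕ, ∀ i j : ℤ, i + 2 * m = j → ∀ x ∈ p i, (e ^ m) x ∈ p j := by
    intro m
    induction m with
    | zero => intro i j h x hx; obtain rfl : i = j := by simpa using h
              simpa using hx
    | succ m ih =>
      intro i j h x hx
      rw [pow_succ', Module.End.mul_apply]
      have := hdeg _ _ (ih i (j - 2) (by push_cast at h; linarith) x hx)
      simpa using this
  have hL : ∀ n : ℕ, ∃ L : Module.End ℝ V,
      (∀ y ∈ p (n : ℤ), L y ∈ p (-(n : ℤ)) ∧ (e ^ n) (L y) = y) ∧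
      ∀ x ∈ p (-(n : ℤ)), L ((e ^ n) x) = x := fun n =>
    aux_inv _ _ _ (hpow n _ _ (by ring)) (hHL n).1 (hHL n).2
  choose L hL1 hL2 using hL
  let g : ℕ → Module.End ℝ V := fun n => L (n + 2) * e ^ (n + 1)
  have hup : ∀ n : ℕ, ∀ x ∈ p (-(n : ℤ)), (e ^ (n + 1)) x ∈ p ((n + 2 : ℕ) : ℤ) :=
    fun n x hx => hpow _ _ _ (by push_cast; ring) x hx
  have hg : ∀ n : ℕ, ∀ x ∈ p (-(n : ℤ)), g n x ∈ p (-((n + 2 : ℕ) : ℤ)) :=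
    fun n x hx => (hL1 (n + 2) _ (hup n x hx)).1
  have hg2 : ∀ n : ℕ, ∀ x ∈ p (-(n : ℤ)), (e ^ (n + 2)) (g n x) = (e ^ (n + 1)) x :=
    fun n x hx => (hL1 (n + 2) _ (hup n x hx)).2
  have hg3 : ∀ n : ℕ, ∀ x ∈ p (-((n + 2 : ℕ) : ℤ)), g n (e x) = x := by
    intro n x hx
    have := hL2 (n + 2) x hx
    rw [pow_succ (n := n + 1)] at this
    exact this
  obtain ⟨F, hF⟩ := aux_F p hp e hdeg g hg
  obtain ⟨h, hh⟩ := aux_glue p hp (fun k => (k : ℝ) • LinearMap.id)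
  obtain ⟨f, hf⟩ := aux_glue p hp (fun k => match k with
    | Int.ofNat n => e ^ n * F n * L n + (n : ℝ) • (e ^ (n - 1) * L n)
    | Int.negSucc n => F (n + 1))
  replace hh : ∀ k : ℤ, ∀ x ∈ p k, h x = (k : ℝ) • x := fun k x hx => by
    rw [hh k x hx]; rfl
  have hpos : ∀ n : ℕ, ∀ x ∈ p (-(n : ℤ)),
      f ((e ^ n) x) = (e ^ n) (F n x) + (n : ℝ) • (e ^ (n - 1)) x := by
    intro n x hx
    rw [hf (n : ℤ) _ (hpow n _ _ (by ring) x hx)]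
    change (e ^ n) (F n (L n ((e ^ n) x))) + (n : ℝ) • (e ^ (n - 1)) (L n ((e ^ n) x)) = _
    rw [hL2 n x hx]
  have hneg : ∀ n : ℕ, ∀ x ∈ p (-(n : ℤ)), f x = F n x := by
    intro n x hx
    cases n with
    | zero => simpa using hpos 0 x hx
    | succ n => exact hf (Int.negSucc n) x hx
  have hfdeg : ∀ k : ℤ, ∀ x ∈ p k, f x ∈ p (k - 2) := by
    intro k x hx
    rcases le_total 0 k with hk | hk
    · obtain ⟨n, rfl⟩ := Int.eq_ofNat_of_zero_le hk
      obtain ⟨y, hy, rfl⟩ := (hHL n).2 x hx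
      rw [hpos n y hy]
      refine Submodule.add_mem _ (hpow n _ _ ?_ _ (hF n y hy).1) ?_
      · push_cast; ring
      · rcases n with _ | n
        · simp
        · refine Submodule.smul_mem _ _ (hpow _ _ _ ?_ y hy)
          simp; ring
    · obtain ⟨n, hn⟩ := Int.eq_ofNat_of_zero_le (neg_nonneg.2 hk)
      obtain rfl : k = -(n : ℤ) := by omega
      rw [hneg n x hx]
      have := (hF n x hx).1
      rwa [show (-((n + 2 : ℕ) : ℤ)) = -(n : ℤ) - 2 by push_cast; ring] at this
  refine ⟨f, h, hh, hfdeg, ?_, ?_, ?_⟩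
  · refine aux_ext p hp _ _ fun k x hx => ?_
    simp only [LinearMap.sub_apply, Module.End.mul_apply, LinearMap.smul_apply]
    rw [hh _ _ (hdeg k x hx), hh k x hx, map_smul]
    push_cast
    module
  · refine aux_ext p hp _ _ fun k x hx => ?_
    simp only [LinearMap.sub_apply, Module.End.mul_apply, LinearMap.smul_apply,
      LinearMap.neg_apply]
    rw [hh _ _ (hfdeg k x hx), hh k x hx, map_smul]
    push_cast
    module
  · refine aux_ext p hp _ _ fun k x hx => ?_
    simp only [LinearMap.sub_apply, Module.End.mul_apply]
    rw [hh k x hx]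
    rcases le_or_gt 0 k with hk | hk
    · obtain ⟨n, rfl⟩ := Int.eq_ofNat_of_zero_le hk
      obtain ⟨y, hy, rfl⟩ := (hHL n).2 x hx
      have e1 : e ((e ^ n) y) = (e ^ (n + 2)) (g n y) := by
        rw [hg2 n y hy, pow_succ']; rfl
      rw [e1, hpos (n + 2) _ (hg n y hy), hpos n y hy, (hF n y hy).2]
      have e2 : ∀ z, (e ^ (n + 2)) z = e ((e ^ n) (e z)) := by
        intro z
        rw [pow_succ, pow_succ']; rfl
      have e3 : ∀ z, (e ^ (n + 2 - 1)) z = e ((e ^ n) z) := by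
        intro z
        rw [show n + 2 - 1 = n + 1 by omega, pow_succ']; rfl
      have e4 : (n : ℝ) • e ((e ^ (n - 1)) y) = (n : ℝ) • (e ^ n) y := by
        rcases n with _ | n
        · simp
        · rw [Nat.add_sub_cancel, pow_succ']; rfl
      rw [e2, e3]
      simp only [map_add, map_smul]
      rw [e4]
      push_cast
      module
    · obtain ⟨n, hn⟩ := Int.eq_ofNat_of_zero_le (neg_nonneg.2 hk.le)
      obtain rfl : k = -(n : ℤ) := by omega
      rcases n with _ | _ | n
      · simp at hk
      · have := hpos 1 x hx
        simp only [pow_one, Nat.sub_self, pow_zero, Module.End.one_apply] at this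
        rw [hneg 1 x hx, zero_add, this]
        push_cast
        module
      · have h1 := hdeg _ _ hx
        rw [show -((n + 1 + 1 : ℕ) : ℤ) + 2 = -(n : ℤ) by push_cast; ring] at h1
        rw [hneg n _ h1, (hF n _ h1).2, hg3 n x hx, hneg (n + 2) x hx]
        push_cast
        module
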